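/- arXiv:2307.07629 — 4 statements merged into one kernel-verified Lean document; each statement's English description precedes it below -/
import Mathlib

section
/- Suppose the experiment choice function X is non-redundant. For any incentive-compatible methods-based contract (X, T), there exists a contingent payment rule t : Θ × Δ(Ω) → ℝ such that (i) E_{p∼X(θ)}[t(θ, p)] = T(θ) for every θ ∈ Θ, and (ii) (X, t) is incentive-compatible with screening: for all θ, θ′ ∈ Θ and every experiment τ, E_{p∼X(θ)}[t(θ, p)] − θ·C(X(θ)) ≥ E_{p∼τ}[t(θ′, p)] − θ·C(τ). -/
open Finset

/-- A finitely supported, Bayes-plausible distribution over posterior beliefs: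
the formal notion of an *experiment*. -/
structure Experiment (Ω : Type*) [Fintype Ω] (p₀ : Ω → ℝ) where
  w : (Ω → ℝ) →₀ ℝ
  nonneg : ∀ p, 0 ≤ w p
  mem_simplex : ∀ p ∈ w.support, p ∈ stdSimplex ℝ Ω
  total : (w.sum fun _ a => a) = 1
  bayes : (w.sum fun p a => a • p) = p₀

namespace Experiment

variable {Ω : Type*} [Fintype Ω] {p₀ : Ω → ℝ}

/-- Expectation `E_{p ∼ τ}[φ(p)]` of a function of the posterior. -/
noncomputable def exp (τ : Experiment Ω p₀) (φ : (Ω → ℝ) → ℝ) : ℝ :=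
  τ.w.sum fun p a => a * φ p

/-- The (finite) support of an experiment. -/
def supp (τ : Experiment Ω p₀) : Finset (Ω → ℝ) := τ.w.support

end Experiment

/-- The support of the experiment is an affinely independent subset of Δ(Ω). -/
def AffIndepSupp {Ω : Type*} [Fintype Ω] {p₀ : Ω → ℝ} (τ : Experiment Ω p₀) : Prop :=
  AffineIndependent ℝ (fun p : (τ.supp : Set (Ω → ℝ)) => (p : Ω → ℝ))

namespace Experiment

variable {Ω : Type*} [Fintype Ω] {p₀ : Ω → ℝ}

theorem exp_eq_sum (τ : Experiment Ω p₀) (φ : (Ω → ℝ) → ℝ) :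
    τ.exp φ = ∑ p ∈ τ.supp, τ.w p * φ p := rfl

theorem exp_mono (τ : Experiment Ω p₀) {φ ψ : (Ω → ℝ) → ℝ} (h : ∀ p ∈ τ.supp, φ p ≤ ψ p) :
    τ.exp φ ≤ τ.exp ψ :=
  Finset.sum_le_sum fun p hp => mul_le_mul_of_nonneg_left (h p hp) (τ.nonneg p)

theorem exp_congr (τ : Experiment Ω p₀) {φ ψ : (Ω → ℝ) → ℝ} (h : ∀ p ∈ τ.supp, φ p = ψ p) :
    τ.exp φ = τ.exp ψ :=
  le_antisymm (τ.exp_mono fun p hp => (h p hp).le) (τ.exp_mono fun p hp => (h p hp).ge)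

theorem exp_add (τ : Experiment Ω p₀) (φ ψ : (Ω → ℝ) → ℝ) :
    τ.exp (fun p => φ p + ψ p) = τ.exp φ + τ.exp ψ := by
  simp only [exp_eq_sum, mul_add, Finset.sum_add_distrib]

theorem exp_const_mul (τ : Experiment Ω p₀) (a : ℝ) (φ : (Ω → ℝ) → ℝ) :
    τ.exp (fun p => a * φ p) = a * τ.exp φ := by
  simp only [exp_eq_sum, Finset.mul_sum]
  exact Finset.sum_congr rfl fun p _ => by ring

theorem exp_const (τ : Experiment Ω p₀) (a : ℝ) : τ.exp (fun _ => a) = a := by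
  have h : ∑ p ∈ τ.supp, τ.w p = 1 := τ.total
  rw [exp_eq_sum, ← Finset.sum_mul, h, one_mul]

/-- By Bayes plausibility, a linear functional of the posterior has mean equal to its value at
the prior. -/
theorem exp_linear (τ : Experiment Ω p₀) (L : (Ω → ℝ) →ₗ[ℝ] ℝ) : τ.exp L = L p₀ := by
  have h : ∑ p ∈ τ.supp, τ.w p • p = p₀ := τ.bayes
  conv_rhs => rw [← h]
  simp [exp_eq_sum]

end Experiment

/-- An affinely independent family in the standard simplex is linearly independent. -/
theorem AffineIndependent.linearIndependent_of_mem_stdSimplex {ι Ω : Type*} [Fintype Ω]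
    {f : ι → Ω → ℝ} (hf : AffineIndependent ℝ f) (hs : ∀ i, f i ∈ stdSimplex ℝ Ω) :
    LinearIndependent ℝ f := by
  rw [linearIndependent_iff']
  intro s w hw
  refine affineIndependent_iff.1 hf s w ?_ hw
  have h : ∑ ω, (∑ i ∈ s, w i • f i) ω = 0 := by rw [hw]; simp
  simp only [Finset.sum_apply, Pi.smul_apply, smul_eq_mul] at h
  rw [Finset.sum_comm] at h
  simpa [← Finset.mul_sum, (hs _).2] using h

/-- Every function on the support of a non-redundant experiment is the restriction of a linear
functional. -/
theorem AffIndepSupp.exists_linear {Ω : Type*} [Fintype Ω] {p₀ : Ω → ℝ} {τ : Experiment Ω p₀}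
    (h : AffIndepSupp τ) (g : (Ω → ℝ) → ℝ) :
    ∃ L : (Ω → ℝ) →ₗ[ℝ] ℝ, ∀ p ∈ τ.supp, L p = g p := by
  have hl := AffineIndependent.linearIndependent_of_mem_stdSimplex h
    fun p => τ.mem_simplex p p.2
  obtain ⟨L, hL⟩ := LinearMap.exists_extend ((Module.Basis.span hl).constr ℝ fun p => g p)
  refine ⟨L, fun p hp => ?_⟩
  have hb := Module.Basis.span_apply hl ⟨p, hp⟩
  have := LinearMap.congr_fun hL (Module.Basis.span hl ⟨p, hp⟩)
  rw [Module.Basis.constr_basis] at this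
  simpa [hb] using this

/-- A single payment rule that pays `S` in expectation for `σ` and holds every type `i` down to
the value `V i`, provided no type `i` strictly gains from `σ` at payment `S`. -/
theorem AffIndepSupp.exists_payment {Ω ι : Type*} [Fintype Ω] {p₀ : Ω → ℝ}
    {σ : Experiment Ω p₀} (h : AffIndepSupp σ) (c : (Ω → ℝ) → ℝ) {s : Finset ι} {j : ι}
    (hj : j ∈ s) (θ V : ι → ℝ) (S : ℝ) (hS : V j = S - θ j * σ.exp c)
    (hV : ∀ i ∈ s, S - θ i * σ.exp c ≤ V i) :
    ∃ t : (Ω → ℝ) → ℝ, σ.exp t = S ∧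
      ∀ i ∈ s, ∀ τ : Experiment Ω p₀, τ.exp t - θ i * τ.exp c ≤ V i := by
  choose L hL using fun i =>
    h.exists_linear fun p => (θ j - θ i) * c p + (V i - (θ j - θ i) * σ.exp c)
  have hLp (i : ι) : L i p₀ = V i := by
    rw [← σ.exp_linear, σ.exp_congr (hL i), Experiment.exp_add, Experiment.exp_const_mul,
      Experiment.exp_const]
    ring
  have hmean (i : ι) (τ : Experiment Ω p₀) :
      τ.exp (fun p => θ i * c p + L i p) = θ i * τ.exp c + V i := by
    rw [Experiment.exp_add, Experiment.exp_const_mul, τ.exp_linear, hLp]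
  refine ⟨fun p => s.inf' ⟨j, hj⟩ fun i => θ i * c p + L i p, ?_, fun i hi τ => ?_⟩
  · have heq : ∀ p ∈ σ.supp,
        (s.inf' ⟨j, hj⟩ fun i => θ i * c p + L i p) = θ j * c p + L j p := by
      intro p hp
      refine le_antisymm (Finset.inf'_le _ hj) (Finset.le_inf' _ _ fun i hi => ?_)
      rw [hL j p hp, hL i p hp]
      linarith [hV i hi]
    rw [σ.exp_congr heq, hmean, hS]
    ring
  · have hle : τ.exp (fun p => s.inf' ⟨j, hj⟩ fun i => θ i * c p + L i p) ≤
        τ.exp fun p => θ i * c p + L i p :=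
      τ.exp_mono fun p _ => Finset.inf'_le _ hi
    linarith [hmean i τ]

/-- Theorem 1: for a non-redundant `𝒳` and any IC methods-based
contract `(𝒳, T)`, there is a contingent payment rule `t(θ, p)` inducing the same
expected payments and incentive-compatible with screening. -/
theorem results_based_payments_with_screening
    {Ω : Type*} [Fintype Ω] [Nonempty Ω]
    (p₀ : Ω → ℝ) (hp₀ : p₀ ∈ stdSimplex ℝ Ω) (hp₀_pos : ∀ ω, 0 < p₀ ω)
    (c : (Ω → ℝ) → ℝ)
    (hc_cont : ContinuousOn c (stdSimplex ℝ Ω))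
    (hc_sconv : StrictConvexOn ℝ (stdSimplex ℝ Ω) c)
    (hc_nonneg : ∀ p ∈ stdSimplex ℝ Ω, 0 ≤ c p)
    (hc_zero : c p₀ = 0)
    (N : ℕ) (hN : 0 < N) (θ : ℕ → ℝ)
    (hθ_pos : ∀ k < N, 0 < θ k)
    (hθ_anti : ∀ i j, i < j → j < N → θ j < θ i)
    (𝒳 : ℕ → Experiment Ω p₀)
    (hnr : ∀ k < N, AffIndepSupp (𝒳 k))
    (T : ℕ → ℝ)
    (hIC : ∀ i < N, ∀ j < N, T j - θ i * (𝒳 j).exp c ≤ T i - θ i * (𝒳 i).exp c) :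
    ∃ t : ℕ → (Ω → ℝ) → ℝ,
      (∀ k < N, (𝒳 k).exp (t k) = T k) ∧
      (∀ i < N, ∀ j < N, ∀ τ : Experiment Ω p₀,
        τ.exp (t j) - θ i * τ.exp c ≤ (𝒳 i).exp (t i) - θ i * (𝒳 i).exp c) := by
  have hex : ∀ k < N, ∃ t : (Ω → ℝ) → ℝ, (𝒳 k).exp t = T k ∧ ∀ i ∈ range N,
      ∀ τ : Experiment Ω p₀, τ.exp t - θ i * τ.exp c ≤ T i - θ i * (𝒳 i).exp c := fun k hk =>
    (hnr k hk).exists_payment c (mem_range.2 hk) θ (fun i => T i - θ i * (𝒳 i).exp c) (T k) rfl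
      fun i hi => hIC i (mem_range.1 hi) k hk
  choose! t ht hle using hex
  refine ⟨t, ht, fun i hi j hj τ => ?_⟩
  rw [ht i hi]
  exact hle j hj i (mem_range.2 hi) τ
end

section
/- Let φ : Δ(Ω) → ℝ be continuous. Then there exists an experiment τ* whose support is an affinely independent subset of Δ(Ω) such that E_{p∼τ*}[φ(p)] ≥ E_{p∼τ}[φ(p)] for every experiment τ; i.e., the Bayesian-persuasion value at the prior p₀ is attained by an experiment with affinely independent support. -/
open Finset

namespace Experiment

variable {Ω : Type*} [Fintype Ω] {p₀ : Ω → ℝ}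

/-- A finite family of weighted posteriors averaging to the prior induces an experiment. -/
theorem exists_of_family (φ : (Ω → ℝ) → ℝ) {ι : Type*} [DecidableEq (Ω → ℝ)] (s : Finset ι)
    (w : ι → ℝ) (z : ι → Ω → ℝ) (hw : ∀ i ∈ s, 0 ≤ w i) (hz : ∀ i ∈ s, z i ∈ stdSimplex ℝ Ω)
    (hsum : ∑ i ∈ s, w i = 1) (hbayes : ∑ i ∈ s, w i • z i = p₀) :
    ∃ τ : Experiment Ω p₀, τ.exp φ = ∑ i ∈ s, w i * φ (z i) ∧ τ.supp ⊆ s.image z := by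
  set f : (Ω → ℝ) →₀ ℝ := ∑ i ∈ s, Finsupp.single (z i) (w i) with hf
  have hsupp : f.support ⊆ s.image z := by
    intro p hp
    by_contra hps
    refine Finsupp.mem_support_iff.mp hp ?_
    rw [hf, Finsupp.finsetSum_apply]
    refine Finset.sum_eq_zero fun i hi => Finsupp.single_eq_of_ne ?_
    rintro rfl
    exact hps (Finset.mem_image_of_mem z hi)
  refine ⟨⟨f, fun p => ?_, fun p hp => ?_, ?_, ?_⟩, ?_, hsupp⟩
  · rw [hf, Finsupp.finsetSum_apply]
    refine Finset.sum_nonneg fun i hi => ?_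
    rw [Finsupp.single_apply]
    split_ifs
    · exact hw i hi
    · exact le_rfl
  · obtain ⟨i, hi, rfl⟩ := Finset.mem_image.mp (hsupp hp)
    exact hz i hi
  · rw [hf, ← Finsupp.sum_finsetSum_index (by simp) (by simp), ← hsum]
    exact Finset.sum_congr rfl fun i _ => Finsupp.sum_single_index rfl
  · rw [hf, ← Finsupp.sum_finsetSum_index (by simp) (by simp [add_smul]), ← hbayes]
    exact Finset.sum_congr rfl fun i _ => Finsupp.sum_single_index (zero_smul _ _)
  · change f.sum _ = _
    rw [hf, ← Finsupp.sum_finsetSum_index (by simp) (by simp [add_mul])]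
    exact Finset.sum_congr rfl fun i _ => Finsupp.sum_single_index (zero_mul _)

/-- If the support is affinely dependent, some posterior can be dropped without loss. -/
theorem exists_card_supp_lt (φ : (Ω → ℝ) → ℝ) (τ : Experiment Ω p₀) (h : ¬ AffIndepSupp τ) :
    ∃ τ' : Experiment Ω p₀, #τ'.supp < #τ.supp ∧ τ.exp φ ≤ τ'.exp φ := by
  classical
  obtain ⟨g, hbary, hzero, hne, hφ⟩ : ∃ g : (Ω → ℝ) → ℝ, ∑ p ∈ τ.supp, g p • p = 0 ∧
      ∑ p ∈ τ.supp, g p = 0 ∧ (∃ p ∈ τ.supp, g p ≠ 0) ∧ ∑ p ∈ τ.supp, g p * φ p ≤ 0 := by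
    obtain ⟨g, hbary, hzero, hne⟩ := exists_nontrivial_relation_sum_zero_of_not_affine_ind h
    rcases le_total (∑ p ∈ τ.supp, g p * φ p) 0 with hle | hle
    · exact ⟨g, hbary, hzero, hne, hle⟩
    · exact ⟨-g, by simpa using hbary, by simpa using hzero, by simpa using hne, by simpa using hle⟩
  obtain ⟨q, hq, hgq⟩ := exists_pos_of_sum_zero_of_exists_nonzero g hzero hne
  obtain ⟨r, hr, hmin⟩ := (τ.supp.filter fun p => 0 < g p).exists_min_image
    (fun p => τ.w p / g p) ⟨q, Finset.mem_filter.mpr ⟨hq, hgq⟩⟩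
  obtain ⟨hrs, hgr⟩ := Finset.mem_filter.mp hr
  set c := τ.w r / g r with hc
  have hc0 : 0 ≤ c := div_nonneg (τ.nonneg r) hgr.le
  have hkr : τ.w r - c * g r = 0 := by rw [hc]; field_simp; ring
  have htotal : ∑ p ∈ τ.supp, τ.w p = 1 := τ.total
  have hbayes : ∑ p ∈ τ.supp, τ.w p • p = p₀ := τ.bayes
  obtain ⟨τ', hexp, hsupp⟩ := exists_of_family (p₀ := p₀) φ (τ.supp.erase r)
    (fun p => τ.w p - c * g p) id
    (by
      intro p hp
      rcases le_or_gt (g p) 0 with hg | hg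
      · have := mul_nonpos_of_nonneg_of_nonpos hc0 hg
        have := τ.nonneg p
        linarith
      · have := hmin p (Finset.mem_filter.mpr ⟨Finset.mem_of_mem_erase hp, hg⟩)
        exact sub_nonneg.mpr ((le_div_iff₀ hg).mp this))
    (fun p hp => τ.mem_simplex p (Finset.mem_of_mem_erase hp))
    (by
      rw [Finset.sum_erase (f := fun p => τ.w p - c * g p) _ hkr,
        Finset.sum_sub_distrib, ← Finset.mul_sum, hzero, htotal]
      simp)
    (by
      rw [Finset.sum_erase _ (by rw [hkr, zero_smul])]
      simp only [id, sub_smul, mul_smul, Finset.sum_sub_distrib, ← Finset.smul_sum, hbary, hbayes]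
      simp)
  refine ⟨τ', ?_, ?_⟩
  · rw [Finset.image_id] at hsupp
    exact (Finset.card_le_card hsupp).trans_lt (Finset.card_erase_lt_of_mem hrs)
  · rw [hexp, Finset.sum_erase _ (by rw [hkr, zero_mul])]
    simp only [id, sub_mul, mul_assoc, Finset.sum_sub_distrib, ← Finset.mul_sum]
    have := mul_nonpos_of_nonneg_of_nonpos hc0 hφ
    change ∑ p ∈ τ.supp, τ.w p * φ p ≤ _
    linarith

/-- Every experiment is weakly dominated by one with affinely independent support. -/
theorem exists_affIndepSupp_exp_ge (φ : (Ω → ℝ) → ℝ) (τ : Experiment Ω p₀) :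
    ∃ τ' : Experiment Ω p₀, AffIndepSupp τ' ∧ τ.exp φ ≤ τ'.exp φ := by
  induction hn : #τ.supp using Nat.strong_induction_on generalizing τ with
  | _ n ih =>
    by_cases h : AffIndepSupp τ
    · exact ⟨τ, h, le_rfl⟩
    · obtain ⟨σ, hcard, hle⟩ := exists_card_supp_lt φ τ h
      obtain ⟨τ', hτ', hle'⟩ := ih _ (hn ▸ hcard) σ rfl
      exact ⟨τ', hτ', hle.trans hle'⟩

/-- The weighted families of `N` posteriors averaging to the prior. -/
def families (p₀ : Ω → ℝ) (N : ℕ) : Set ((Fin N → ℝ) × (Fin N → Ω → ℝ)) :=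
  (stdSimplex ℝ (Fin N) ×ˢ Set.univ.pi fun _ => stdSimplex ℝ Ω) ∩
    {x | ∑ i, x.1 i • x.2 i = p₀}

theorem isCompact_families (p₀ : Ω → ℝ) (N : ℕ) : IsCompact (families p₀ N) :=
  ((isCompact_stdSimplex ℝ _).prod
    (isCompact_univ_pi fun _ => isCompact_stdSimplex ℝ _)).inter_right
    (isClosed_eq (by fun_prop) continuous_const)

theorem continuousOn_families {φ : (Ω → ℝ) → ℝ} (hφ : ContinuousOn φ (stdSimplex ℝ Ω)) (N : ℕ) :
    ContinuousOn (fun x : (Fin N → ℝ) × (Fin N → Ω → ℝ) => ∑ i, x.1 i * φ (x.2 i))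
      (families p₀ N) := by
  refine continuousOn_finsetSum _ fun i _ => ContinuousOn.mul (by fun_prop) ?_
  exact hφ.comp (by fun_prop) fun x hx => hx.1.2 i (Set.mem_univ i)

/-- An experiment with at most `N` posteriors is represented by a family of length `N`. -/
theorem exists_mem_families (hp₀ : p₀ ∈ stdSimplex ℝ Ω) (φ : (Ω → ℝ) → ℝ) {N : ℕ}
    (τ : Experiment Ω p₀) (hN : #τ.supp ≤ N) :
    ∃ x ∈ families p₀ N, ∑ i, x.1 i * φ (x.2 i) = τ.exp φ := by
  classical
  obtain ⟨e⟩ : Nonempty (τ.supp ↪ Fin N) :=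
    Function.Embedding.nonempty_of_card_le (by simpa using hN)
  set w : Fin N → ℝ := Function.extend e (fun p => τ.w p) 0
  set z : Fin N → Ω → ℝ := Function.extend e (fun p => (p : Ω → ℝ)) fun _ => p₀
  have hwe (p) : w (e p) = τ.w p := e.injective.extend_apply _ _ _
  have hze (p) : z (e p) = p := e.injective.extend_apply _ _ _
  have hw0 (i) (hi : i ∉ Set.range e) : w i = 0 := Function.extend_apply' _ _ _ hi
  have hz0 (i) (hi : i ∉ Set.range e) : z i = p₀ := Function.extend_apply' _ _ _ hi
  refine ⟨(w, z), ⟨⟨⟨fun i => ?_, ?_⟩, fun i _ => ?_⟩, ?_⟩, ?_⟩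
  · by_cases hi : i ∈ Set.range e
    · obtain ⟨p, rfl⟩ := hi
      exact (τ.nonneg p).trans_eq (hwe p).symm
    · exact (hw0 i hi).ge
  · rw [← Fintype.sum_of_injective e e.injective (fun p => τ.w p) _ hw0 fun p => (hwe p).symm]
    exact (Finset.sum_coe_sort τ.supp fun p => τ.w p).trans τ.total
  · by_cases hi : i ∈ Set.range e
    · obtain ⟨p, rfl⟩ := hi
      simpa only [hze] using τ.mem_simplex p p.2
    · simpa only [hz0 i hi] using hp₀
  · change ∑ i, w i • z i = p₀
    rw [← Fintype.sum_of_injective e e.injective (fun p => τ.w p • (p : Ω → ℝ)) _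
      (fun i hi => by rw [hw0 i hi, zero_smul]) fun p => by rw [hwe, hze]]
    exact (Finset.sum_coe_sort τ.supp fun p => τ.w p • p).trans τ.bayes
  · change ∑ i, w i * φ (z i) = _
    rw [← Fintype.sum_of_injective e e.injective (fun p => τ.w p * φ p) _
      (fun i hi => by rw [hw0 i hi, zero_mul]) fun p => by rw [hwe, hze]]
    exact Finset.sum_coe_sort τ.supp fun p => τ.w p * φ p

theorem card_supp_le {τ : Experiment Ω p₀} (h : AffIndepSupp τ) :
    #τ.supp ≤ Fintype.card Ω + 1 := by
  have hcard := AffineIndependent.card_le_finrank_succ h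
  have hrank := Submodule.finrank_le
    (vectorSpan ℝ (Set.range fun p : (τ.supp : Set (Ω → ℝ)) => (p : Ω → ℝ)))
  rw [Module.finrank_fintype_fun_eq_card] at hrank
  have : Fintype.card (τ.supp : Set (Ω → ℝ)) = #τ.supp := by simp
  omega

end Experiment

/-- the Bayesian-persuasion value of a continuous objective is attained
by an experiment with affinely independent support. -/
theorem persuasion_value_attained_affinely_independent
    {Ω : Type*} [Fintype Ω] [Nonempty Ω]
    (p₀ : Ω → ℝ) (hp₀ : p₀ ∈ stdSimplex ℝ Ω) (hp₀_pos : ∀ ω, 0 < p₀ ω)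
    (φ : (Ω → ℝ) → ℝ) (hφ : ContinuousOn φ (stdSimplex ℝ Ω)) :
    ∃ τs : Experiment Ω p₀, AffIndepSupp τs ∧
      ∀ τ : Experiment Ω p₀, τ.exp φ ≤ τs.exp φ := by
  classical
  have hnonempty : (Experiment.families p₀ (Fintype.card Ω + 1)).Nonempty := by
    obtain ⟨τ, -, -⟩ := Experiment.exists_of_family (p₀ := p₀) φ (Finset.univ : Finset Unit)
      (fun _ => 1) (fun _ => p₀) (by simp) (fun _ _ => hp₀) (by simp) (by simp)
    obtain ⟨τ', hτ', -⟩ := τ.exists_affIndepSupp_exp_ge φ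
    obtain ⟨x, hx, -⟩ := τ'.exists_mem_families hp₀ φ (Experiment.card_supp_le hτ')
    exact ⟨x, hx⟩
  obtain ⟨x, hx, hmax⟩ := (Experiment.isCompact_families p₀ _).exists_isMaxOn hnonempty
    (Experiment.continuousOn_families hφ _)
  obtain ⟨σ, hσ, -⟩ := Experiment.exists_of_family φ Finset.univ x.1 x.2
    (fun i _ => hx.1.1.1 i) (fun i _ => hx.1.2 i (Set.mem_univ i)) hx.1.1.2 hx.2
  obtain ⟨τs, hτs, hle⟩ := σ.exists_affIndepSupp_exp_ge φ
  refine ⟨τs, hτs, fun τ => ?_⟩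
  obtain ⟨τ', hτ', hττ'⟩ := τ.exists_affIndepSupp_exp_ge φ
  obtain ⟨y, hy, hyτ'⟩ := τ'.exists_mem_families hp₀ φ (Experiment.card_supp_le hτ')
  calc τ.exp φ ≤ τ'.exp φ := hττ'
    _ = ∑ i, y.1 i * φ (y.2 i) := hyτ'.symm
    _ ≤ ∑ i, x.1 i * φ (x.2 i) := hmax hy
    _ = σ.exp φ := hσ.symm
    _ ≤ τs.exp φ := hle
end

section
/- Let τ and τ′ be experiments (finitely supported probability distributions on Δ(Ω) with barycenter p₀), and suppose the support of τ′ is affinely independent. Then τ′ is a mean-preserving spread of τ — i.e., E_{p∼τ′}[f(p)] ≥ E_{p∼τ}[f(p)] for every continuous convex function f : Δ(Ω) → ℝ — if and only if supp(τ) ⊆ conv(supp(τ′)). -/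
open Finset

theorem AffineIndependent.eqOn_weights_of_sum_smul_eq {E : Type*} [AddCommGroup E] [Module ℝ E]
    {s : Finset E} (hs : AffineIndependent ℝ (fun p : (s : Set E) => (p : E))) {a b : E → ℝ}
    (hsum : ∑ p ∈ s, a p = ∑ p ∈ s, b p) (hbary : ∑ p ∈ s, a p • p = ∑ p ∈ s, b p • p) :
    ∀ p ∈ s, a p = b p := by
  intro p hp
  have h1 : ∑ q : (s : Set E), (a q - b q) = 0 := by
    refine (Finset.sum_coe_sort s (fun q => a q - b q)).trans ?_
    rw [Finset.sum_sub_distrib, hsum, sub_self]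
  have h2 : ∑ q : (s : Set E), (a q - b q) • (q : E) = 0 := by
    refine (Finset.sum_coe_sort s (fun q => (a q - b q) • q)).trans ?_
    simp only [sub_smul]
    rw [Finset.sum_sub_distrib, hbary, sub_self]
  exact sub_eq_zero.mp
    (affineIndependent_iff.mp hs Finset.univ (fun q => a q - b q) h1 h2 ⟨p, hp⟩ (mem_univ _))

namespace Experiment

variable {Ω : Type*} [Fintype Ω] {p₀ : Ω → ℝ}

theorem supp_subset_convexHull_of_exp_le {τ τ' : Experiment Ω p₀}
    (h : ∀ f : (Ω → ℝ) → ℝ, ContinuousOn f (stdSimplex ℝ Ω) →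
      ConvexOn ℝ (stdSimplex ℝ Ω) f → τ.exp f ≤ τ'.exp f) :
    (τ.supp : Set (Ω → ℝ)) ⊆ convexHull ℝ (τ'.supp : Set (Ω → ℝ)) := by
  intro p hp
  by_contra hpK
  obtain ⟨l, u, hlu, hup⟩ := geometric_hahn_banach_closed_point
    (convex_convexHull ℝ (τ'.supp : Set (Ω → ℝ)))
    (τ'.supp.finite_toSet.isClosed_convexHull ℝ) hpK
  have hcvx : ConvexOn ℝ (stdSimplex ℝ Ω) (fun q => max (l q - u) 0) := by
    simp only [sub_eq_add_neg]
    exact (ConvexOn.add_const (l.toLinearMap.convexOn (convex_stdSimplex ℝ Ω)) (-u)).sup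
      (convexOn_const 0 (convex_stdSimplex ℝ Ω))
  have hle := h (fun q => max (l q - u) 0) (by fun_prop) hcvx
  have hzero : τ'.exp (fun q => max (l q - u) 0) = 0 := by
    refine Finset.sum_eq_zero fun q hq => ?_
    have hlq : l q < u := hlu q (subset_convexHull ℝ _ hq)
    exact mul_eq_zero_of_right _ (max_eq_right (sub_nonpos.mpr hlq.le))
  have hpos : 0 < τ.exp (fun q => max (l q - u) 0) := by
    refine Finset.sum_pos' (fun q _ => mul_nonneg (τ.nonneg q) (le_max_right _ _)) ⟨p, hp, ?_⟩
    exact mul_pos ((τ.nonneg p).lt_of_ne' (Finsupp.mem_support_iff.mp hp))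
      (lt_max_of_lt_left (sub_pos.mpr hup))
  linarith

theorem exp_le_exp_of_supp_subset_convexHull {τ τ' : Experiment Ω p₀} (hτ' : AffIndepSupp τ')
    (h : (τ.supp : Set (Ω → ℝ)) ⊆ convexHull ℝ (τ'.supp : Set (Ω → ℝ)))
    {f : (Ω → ℝ) → ℝ} (hf : ConvexOn ℝ (stdSimplex ℝ Ω) f) : τ.exp f ≤ τ'.exp f := by
  have hex : ∀ p ∈ τ.supp, ∃ c : (Ω → ℝ) → ℝ, (∀ q ∈ τ'.supp, 0 ≤ c q) ∧
      ∑ q ∈ τ'.supp, c q = 1 ∧ ∑ q ∈ τ'.supp, c q • q = p :=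
    fun p hp => Finset.mem_convexHull'.mp (h hp)
  choose! c hc0 hc1 hcp using hex
  have hw : ∀ q ∈ τ'.supp, ∑ p ∈ τ.supp, τ.w p * c p q = τ'.w q := by
    refine hτ'.eqOn_weights_of_sum_smul_eq (a := fun q => ∑ p ∈ τ.supp, τ.w p * c p q) ?_ ?_
    · calc ∑ q ∈ τ'.supp, ∑ p ∈ τ.supp, τ.w p * c p q
          = ∑ p ∈ τ.supp, τ.w p := by
            rw [Finset.sum_comm]
            refine Finset.sum_congr rfl fun p hp => ?_
            rw [← Finset.mul_sum, hc1 p hp, mul_one]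
        _ = ∑ q ∈ τ'.supp, τ'.w q := τ.total.trans τ'.total.symm
    · calc ∑ q ∈ τ'.supp, (∑ p ∈ τ.supp, τ.w p * c p q) • q
          = ∑ p ∈ τ.supp, τ.w p • p := by
            simp only [Finset.sum_smul, mul_smul]
            rw [Finset.sum_comm]
            refine Finset.sum_congr rfl fun p hp => ?_
            rw [← Finset.smul_sum, hcp p hp]
        _ = ∑ q ∈ τ'.supp, τ'.w q • q := τ.bayes.trans τ'.bayes.symm
  calc τ.exp f ≤ ∑ p ∈ τ.supp, τ.w p * ∑ q ∈ τ'.supp, c p q * f q := by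
        refine Finset.sum_le_sum fun p hp => mul_le_mul_of_nonneg_left ?_ (τ.nonneg p)
        have := hf.map_sum_le (hc0 p hp) (hc1 p hp) τ'.mem_simplex
        rwa [hcp p hp] at this
    _ = ∑ q ∈ τ'.supp, (∑ p ∈ τ.supp, τ.w p * c p q) * f q := by
        simp only [Finset.mul_sum, Finset.sum_mul, mul_assoc]
        exact Finset.sum_comm
    _ = τ'.exp f := Finset.sum_congr rfl fun q hq => by rw [hw q hq]

end Experiment

/-- Lemma 3, geometric Blackwell theorem: if `τ'` has affinely
independent support, then `τ'` is a mean-preserving spread of `τ` iff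
`supp(τ) ⊆ conv(supp(τ'))`. -/
theorem mps_iff_support_subset_convexHull
    {Ω : Type*} [Fintype Ω] [Nonempty Ω]
    (p₀ : Ω → ℝ) (hp₀ : p₀ ∈ stdSimplex ℝ Ω) (hp₀_pos : ∀ ω, 0 < p₀ ω)
    (τ τ' : Experiment Ω p₀) (hτ' : AffIndepSupp τ') :
    (∀ f : (Ω → ℝ) → ℝ, ContinuousOn f (stdSimplex ℝ Ω) →
      ConvexOn ℝ (stdSimplex ℝ Ω) f → τ.exp f ≤ τ'.exp f) ↔
    (τ.supp : Set (Ω → ℝ)) ⊆ convexHull ℝ (τ'.supp : Set (Ω → ℝ)) := by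
  exact ⟨Experiment.supp_subset_convexHull_of_exp_le,
    fun h _ _ hf => Experiment.exp_le_exp_of_supp_subset_convexHull hτ' h hf⟩
end

section
/- Let u : Δ(Ω) → ℝ be any function, let τ* be an experiment, and let s : Δ(Ω) → ℝ be an affine function such that s(p) ≥ u(p) for every p ∈ Δ(Ω) and s(p) = u(p) for every p ∈ supp(τ*). Then E_{p∼τ*}[u(p)] = s(p₀), and for every experiment τ, E_{p∼τ}[u(p)] ≤ E_{p∼τ*}[u(p)]; i.e., τ* maximizes the expectation of u among all Bayes-plausible experiments. -/
open Finset

theorem Experiment.exp_affine {Ω : Type*} [Fintype Ω] {p₀ : Ω → ℝ} (τ : Experiment Ω p₀)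
    (s : (Ω → ℝ) →ᵃ[ℝ] ℝ) : τ.exp s = s p₀ := by
  have htotal := τ.total
  have hbayes := τ.bayes
  simp only [Finsupp.sum] at htotal hbayes
  have hs : ∀ p, s p = s.linear p + s 0 := fun p => congrFun s.decomp p
  have hlin := congrArg s.linear hbayes
  simp only [map_sum, map_smul, smul_eq_mul] at hlin
  simp only [Experiment.exp, Finsupp.sum]
  calc ∑ p ∈ τ.w.support, τ.w p * s p
      = ∑ p ∈ τ.w.support, (τ.w p * s.linear p + τ.w p * s 0) :=
        Finset.sum_congr rfl fun p _ => by rw [hs p, mul_add]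
    _ = s p₀ := by
        rw [Finset.sum_add_distrib, ← Finset.sum_mul, htotal, one_mul, hlin, ← hs p₀]

/-- if an affine function `s` dominates `u` on Δ(Ω) and agrees with
`u` on the support of `τ*`, then `τ*` attains value `s(p₀)` and maximizes the
expectation of `u` over all experiments. -/
theorem touching_hyperplane_implies_optimal
    {Ω : Type*} [Fintype Ω] [Nonempty Ω]
    (p₀ : Ω → ℝ) (hp₀ : p₀ ∈ stdSimplex ℝ Ω) (hp₀_pos : ∀ ω, 0 < p₀ ω)
    (u : (Ω → ℝ) → ℝ) (τs : Experiment Ω p₀)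
    (s : (Ω → ℝ) →ᵃ[ℝ] ℝ)
    (hs_ge : ∀ p ∈ stdSimplex ℝ Ω, u p ≤ s p)
    (hs_eq : ∀ p ∈ τs.supp, s p = u p) :
    τs.exp u = s p₀ ∧ ∀ τ : Experiment Ω p₀, τ.exp u ≤ τs.exp u := by
  have hval : τs.exp u = s p₀ := by
    rw [← τs.exp_affine s]
    exact Finset.sum_congr rfl fun p hp => by simp only [hs_eq p hp]
  refine ⟨hval, fun τ => ?_⟩
  rw [hval, ← τ.exp_affine s]
  exact Finset.sum_le_sum fun p hp =>
    mul_le_mul_of_nonneg_left (hs_ge p (τ.mem_simplex p hp)) (τ.nonneg p)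
end
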